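/- Let ω₀, r, ξ be real numbers with ω₀ > 0, r > 0, r ≠ 1 and 0 < ξ ≤ 1, and set β = 2ξ² − 1. If ω is a real number satisfying n(ω, 1) = 0 and (∂n/∂ω)(ω, 1) = 0, then ω = 0. In particular, the only real common root of n(·, 1) and (∂n/∂ω)(·, 1) is ω = 0, and (ω, γ) = (0, 1) is indeed such a common solution. -/

import Mathlib

/-- The bivariate polynomial
`n(ω, γ) = (γ² − r⁴)ω⁴ + 2r²ω₀²β(γ² − r²)ω² + r⁴ω₀⁴(γ² − 1)`. -/
def nPoly (ω₀ r β : ℝ) (ω γ : ℝ) : ℝ :=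
  (γ ^ 2 - r ^ 4) * ω ^ 4 + 2 * r ^ 2 * ω₀ ^ 2 * β * (γ ^ 2 - r ^ 2) * ω ^ 2 +
    r ^ 4 * ω₀ ^ 4 * (γ ^ 2 - 1)

/-- The partial derivative of `nPoly` with respect to `ω`. -/
theorem hasDerivAt_nPoly (ω₀ r β ω γ : ℝ) :
    HasDerivAt (fun w => nPoly ω₀ r β w γ)
      (4 * (γ ^ 2 - r ^ 4) * ω ^ 3 + 4 * r ^ 2 * ω₀ ^ 2 * β * (γ ^ 2 - r ^ 2) * ω) ω := by
  unfold nPoly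
  refine ((((hasDerivAt_pow 4 ω).const_mul (γ ^ 2 - r ^ 4)).add
    ((hasDerivAt_pow 2 ω).const_mul (2 * r ^ 2 * ω₀ ^ 2 * β * (γ ^ 2 - r ^ 2)))).add_const
      (r ^ 4 * ω₀ ^ 4 * (γ ^ 2 - 1))).congr_deriv ?_
  norm_num
  ring

/-- For `γ = 1`, the only real common root of `n(·, 1)` and `∂n/∂ω(·, 1)` is `ω = 0`,
and `(ω, γ) = (0, 1)` is indeed such a common solution. -/
theorem gamma_one_common_root (ω₀ r ξ β : ℝ)
    (hω₀ : 0 < ω₀) (hr : 0 < r) (hr1 : r ≠ 1) (hξ₁ : 0 < ξ) (hξ₂ : ξ ≤ 1)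
    (hβ : β = 2 * ξ ^ 2 - 1) :
    (∀ ω : ℝ, nPoly ω₀ r β ω 1 = 0 → deriv (fun w => nPoly ω₀ r β w 1) ω = 0 → ω = 0) ∧
    nPoly ω₀ r β 0 1 = 0 ∧ deriv (fun w => nPoly ω₀ r β w 1) 0 = 0 := by
  refine ⟨fun ω hn hd => ?_, by simp [nPoly], by simp [(hasDerivAt_nPoly ω₀ r β 0 1).deriv]⟩
  rw [(hasDerivAt_nPoly ω₀ r β ω 1).deriv] at hd
  unfold nPoly at hn
  have hmul : (1 - r ^ 4) * ω ^ 4 = 0 := by linear_combination ω / 2 * hd - hn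
  have hr4 : 1 - r ^ 4 ≠ 0 := fun h =>
    hr1 ((pow_eq_one_iff_of_nonneg hr.le four_ne_zero).mp (sub_eq_zero.mp h).symm)
  exact eq_zero_of_pow_eq_zero ((mul_eq_zero.mp hmul).resolve_left hr4)
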